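/- Let Δ be a finite polar space of rank n ≥ 2 and order (s,t). Then for every set T' of at most s singular subspaces of a fixed dimension k ≤ n−2 (respectively at most t maximal singular subspaces when t > 1), there exists a singular subspace of the same dimension opposite every member of T'. -/

import Mathlib

/-- A polar space (Buekenhout–Shult axioms). -/
structure PolarSpace (P : Type*) where
  lines : Set (Set P)
  linesNonempty : lines.Nonempty
  thickLines : ∀ L ∈ lines, ∃ a b c : P, a ∈ L ∧ b ∈ L ∧ c ∈ L ∧ a ≠ b ∧ a ≠ c ∧ b ≠ c
  oneOrAll : ∀ (p : P), ∀ L ∈ lines,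
    (∃! q, q ∈ L ∧ (p = q ∨ ∃ M ∈ lines, p ∈ M ∧ q ∈ M)) ∨
    (∀ q ∈ L, p = q ∨ ∃ M ∈ lines, p ∈ M ∧ q ∈ M)
  nondegenerate : ∀ p : P, ∃ q : P, ¬ (p = q ∨ ∃ M ∈ lines, p ∈ M ∧ q ∈ M)

/-- Collinearity (a point is collinear with itself). -/
def PolarSpace.collin {P : Type*} (Δ : PolarSpace P) (p q : P) : Prop :=
  p = q ∨ ∃ L ∈ Δ.lines, p ∈ L ∧ q ∈ L

/-- A subspace: contains every line meeting it in at least two points. -/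
def PolarSpace.IsSubspace {P : Type*} (Δ : PolarSpace P) (X : Set P) : Prop :=
  ∀ L ∈ Δ.lines, (∃ a b : P, a ∈ L ∧ b ∈ L ∧ a ≠ b ∧ a ∈ X ∧ b ∈ X) → L ⊆ X

/-- A singular subspace. -/
def PolarSpace.IsSingular {P : Type*} (Δ : PolarSpace P) (X : Set P) : Prop :=
  Δ.IsSubspace X ∧ ∀ a ∈ X, ∀ b ∈ X, Δ.collin a b

/-- A strictly increasing chain of `k+1` singular subspaces starting at a point
and ending at `S`; its existence witnesses that `S` has dimension at least `k`. -/
def PolarSpace.HasChain {P : Type*} (Δ : PolarSpace P) (k : ℕ) (S : Set P) : Prop :=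
  ∃ c : Fin (k + 1) → Set P, (∀ i, Δ.IsSingular (c i)) ∧
    (∀ i j : Fin (k + 1), i < j → c i ⊂ c j) ∧
    (c 0).ncard = 1 ∧ c (Fin.last k) = S

/-- The (projective) dimension of a singular subspace. -/
def PolarSpace.SingDim {P : Type*} (Δ : PolarSpace P) (S : Set P) (k : ℕ) : Prop :=
  Δ.IsSingular S ∧ Δ.HasChain k S ∧ ¬ Δ.HasChain (k + 1) S

/-- Opposition of singular subspaces. -/
def PolarSpace.Opposite {P : Type*} (Δ : PolarSpace P) (U W : Set P) : Prop :=
  ∀ p ∈ U ∪ W, ∃ x ∈ U ∪ W, ¬ Δ.collin p x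

namespace PolarSpace

open Set

variable {P : Type*} (Δ : PolarSpace P)

theorem cr (p : P) : Δ.collin p p := Or.inl rfl

variable {Δ}

theorem cs {p q : P} (h : Δ.collin p q) : Δ.collin q p := by
  rcases h with rfl | ⟨L, hL, h1, h2⟩
  · exact Or.inl rfl
  · exact Or.inr ⟨L, hL, h2, h1⟩

theorem on_line {L : Set P} (hL : L ∈ Δ.lines) {p q : P} (hp : p ∈ L) (hq : q ∈ L) :
    Δ.collin p q := Or.inr ⟨L, hL, hp, hq⟩

theorem exists_line {p q : P} (h : Δ.collin p q) (hne : p ≠ q) :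
    ∃ L ∈ Δ.lines, p ∈ L ∧ q ∈ L := by
  rcases h with h | h
  · exact absurd h hne
  · exact h

theorem one (p : P) {L : Set P} (hL : L ∈ Δ.lines) : ∃ q ∈ L, Δ.collin p q := by
  rcases Δ.oneOrAll p L hL with ⟨q, ⟨h1, h2⟩, _⟩ | h
  · exact ⟨q, h1, h2⟩
  · obtain ⟨a, _, _, ha, _⟩ := Δ.thickLines L hL
    exact ⟨a, ha, h a ha⟩

theorem two {p a b : P} {L : Set P} (hL : L ∈ Δ.lines) (ha : a ∈ L) (hb : b ∈ L) (hab : a ≠ b)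
    (h1 : Δ.collin p a) (h2 : Δ.collin p b) {q : P} (hq : q ∈ L) : Δ.collin p q := by
  rcases Δ.oneOrAll p L hL with ⟨q', _, h⟩ | h
  · exact absurd ((h a ⟨ha, h1⟩).trans (h b ⟨hb, h2⟩).symm) hab
  · exact h q hq

variable (Δ) in
/-- Points collinear with all of `X`. -/
def perp (X : Set P) : Set P := {p | ∀ x ∈ X, Δ.collin p x}

theorem mem_perp {X : Set P} {p : P} : p ∈ Δ.perp X ↔ ∀ x ∈ X, Δ.collin p x := Iff.rfl

theorem mem_perp1 {y p : P} : p ∈ Δ.perp {y} ↔ Δ.collin p y := by simp [perp]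

theorem perp_anti {X Y : Set P} (h : X ⊆ Y) : Δ.perp Y ⊆ Δ.perp X :=
  fun _ hp x hx => hp x (h hx)

theorem perp_subspace (X : Set P) : Δ.IsSubspace (Δ.perp X) := by
  rintro L hL ⟨a, b, ha, hb, hab, ha', hb'⟩ q hq x hx
  exact cs (two hL ha hb hab (cs (ha' x hx)) (cs (hb' x hx)) hq)

theorem sub_of {X L : Set P} (hX : Δ.IsSubspace X) (hL : L ∈ Δ.lines) {a b q : P} (ha : a ∈ L)
    (hb : b ∈ L) (hab : a ≠ b) (ha' : a ∈ X) (hb' : b ∈ X) (hq : q ∈ L) : q ∈ X :=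
  hX L hL ⟨a, b, ha, hb, hab, ha', hb'⟩ hq

theorem sub_inter {X Y : Set P} (hX : Δ.IsSubspace X) (hY : Δ.IsSubspace Y) :
    Δ.IsSubspace (X ∩ Y) := by
  rintro L hL ⟨a, b, ha, hb, hab, ha', hb'⟩ q hq
  exact ⟨sub_of hX hL ha hb hab ha'.1 hb'.1 hq, sub_of hY hL ha hb hab ha'.2 hb'.2 hq⟩

theorem sing_inter {X Y : Set P} (hX : Δ.IsSingular X) (hY : Δ.IsSubspace Y) :
    Δ.IsSingular (X ∩ Y) :=
  ⟨sub_inter hX.1 hY, fun a ha b hb => hX.2 a ha.1 b hb.1⟩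

theorem sing_perp {X : Set P} (hX : Δ.IsSingular X) (Y : Set P) : Δ.IsSingular (X ∩ Δ.perp Y) :=
  sing_inter hX (perp_subspace Y)

theorem sub_perp {X : Set P} (hX : Δ.IsSingular X) : X ⊆ Δ.perp X :=
  fun a ha b hb => hX.2 a ha b hb

theorem core {X : Set P} {a b z r : P} (hb : b ∈ Δ.perp X) (hz : z ∈ Δ.perp X)
    (hr : r ∈ Δ.perp X) (hab : Δ.collin a b) (hzb : Δ.collin z b) (hza : ¬ Δ.collin z a)
    (hrb : ¬ Δ.collin r b) : ∃ v ∈ Δ.perp X, Δ.collin v a ∧ ¬ Δ.collin v b := by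
  have hzb' : z ≠ b := by
    rintro rfl; exact hza (cs hab)
  obtain ⟨M, hM, zM, bM⟩ := exists_line hzb hzb'
  obtain ⟨w, wM, hw⟩ := one r hM
  have hwb : w ≠ b := by
    rintro rfl; exact hrb hw
  have hwX : w ∈ Δ.perp X := sub_of (perp_subspace X) hM zM bM hzb' hz hb wM
  have hwa : ¬ Δ.collin a w := fun h => hza (cs (two hM wM bM hwb h hab zM))
  have hrw : r ≠ w := by
    rintro rfl; exact hrb (on_line hM wM bM)
  obtain ⟨N, hN, rN, wN⟩ := exists_line hw hrw
  obtain ⟨v, vN, hv⟩ := one a hN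
  have hvw : v ≠ w := by
    rintro rfl; exact hwa hv
  refine ⟨v, sub_of (perp_subspace X) hN rN wN hrw hr hwX vN, cs hv, fun h => hrb ?_⟩
  exact cs (two hN vN wN hvw (cs h) (on_line hM bM wM) rN)

theorem gen {K : Set P} (hK : Δ.IsSingular K) {y p v : P} (hp : p ∈ K) (hyp : ¬ Δ.collin p y)
    (h1 : v ∈ Δ.perp (K ∩ Δ.perp {y})) (h2 : Δ.collin v p) : v ∈ Δ.perp K := by
  intro c hc
  by_cases hcp : c = p
  · exact hcp ▸ h2
  obtain ⟨L, hL, cL, pL⟩ := exists_line (hK.2 c hc p hp) hcp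
  obtain ⟨q, qL, hq⟩ := one y hL
  have hqp : q ≠ p := by
    rintro rfl; exact hyp (cs hq)
  have hqK : q ∈ K := sub_of hK.1 hL cL pL hcp hc hp qL
  exact two hL qL pL hqp (h1 q ⟨hqK, mem_perp1.2 (cs hq)⟩) h2 cL

theorem residue [Finite P] : ∀ (m : ℕ) (X : Set P), X.ncard = m → Δ.IsSingular X →
    ∀ x ∈ Δ.perp X, x ∉ X → ∃ y ∈ Δ.perp X, ¬ Δ.collin y x := by
  intro m
  induction m using Nat.strong_induction_on with
  | _ m ih =>
  intro X hm hX x hx hxX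
  obtain ⟨y, hy⟩ := Δ.nondegenerate x
  change ¬ Δ.collin x y at hy
  by_cases hyX : y ∈ Δ.perp X
  · exact ⟨y, hyX, fun h => hy (cs h)⟩
  rw [mem_perp] at hyX
  push Not at hyX
  obtain ⟨p, hp, hyp⟩ := hyX
  have hxp : x ≠ p := by
    rintro rfl; exact hxX hp
  obtain ⟨L, hL, xL, pL⟩ := exists_line (hx p hp) hxp
  obtain ⟨q, qL, hq⟩ := one y hL
  have hqp : q ≠ p := by
    rintro rfl; exact hyp hq
  have hqX : q ∉ X := fun h => hxX (sub_of hX.1 hL qL pL hqp h hp xL)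
  have hqX' : q ∈ Δ.perp X := sub_of (perp_subspace X) hL xL pL hxp hx (sub_perp hX hp) qL
  have hHX : X ∩ Δ.perp {y} ⊆ X := inter_subset_left
  have hlt : (X ∩ Δ.perp {y}).ncard < m := by
    rw [← hm]
    apply ncard_lt_ncard _ (toFinite _)
    refine ⟨hHX, fun h => hyp (cs (mem_perp1.1 (h hp).2))⟩
  obtain ⟨r, hr, hrq⟩ := ih _ hlt _ rfl (sing_perp hX {y}) q (perp_anti hHX hqX')
    (fun h => hqX h.1)
  obtain ⟨v, hv, hvp, hvq⟩ := core (X := X ∩ Δ.perp {y}) (a := p) (b := q) (z := y) (r := r)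
    (perp_anti hHX hqX') (fun c hc => cs (mem_perp1.1 hc.2)) hr (on_line hL pL qL) hq hyp hrq
  refine ⟨v, gen hX hp (fun h => hyp (cs h)) hv hvp, fun h => hvq ?_⟩
  exact two hL xL pL hxp h hvp qL

theorem res [Finite P] {X : Set P} (hX : Δ.IsSingular X) {x : P} (hx : x ∈ Δ.perp X)
    (hxX : x ∉ X) : ∃ y ∈ Δ.perp X, ¬ Δ.collin y x := residue _ X rfl hX x hx hxX

theorem sing_pt (a : P) : Δ.IsSingular {a} := by
  refine ⟨?_, ?_⟩
  · rintro L hL ⟨c, b, hc, hb, hcb, hc', hb'⟩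
    exact absurd (hc'.trans hb'.symm) hcb
  · rintro c rfl b rfl; exact cr Δ _

theorem incomp [Finite P] {a b : P} (hab : a ≠ b) : ∃ z, Δ.collin z a ∧ ¬ Δ.collin z b := by
  by_cases h : Δ.collin a b
  · obtain ⟨y, h1, h2⟩ := res (sing_pt (Δ := Δ) a) (mem_perp1.2 (cs h)) (fun h' => hab h'.symm)
    exact ⟨y, mem_perp1.1 h1, h2⟩
  · exact ⟨a, cr Δ a, h⟩

theorem plin [Finite P] {L M : Set P} (hL : L ∈ Δ.lines) (hM : M ∈ Δ.lines) {p x : P}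
    (hpx : p ≠ x) (pL : p ∈ L) (xL : x ∈ L) (pM : p ∈ M) (xM : x ∈ M) : L ⊆ M := by
  intro y yL
  by_contra yM
  have hyx : y ≠ x := by
    rintro rfl; exact yM xM
  have hyp : y ≠ p := by
    rintro rfl; exact yM pM
  obtain ⟨z, hzy, hzx⟩ := incomp (Δ := Δ) hyx
  obtain ⟨u, uM, hzu⟩ := one z hM
  have hux : u ≠ x := by
    rintro rfl; exact hzx hzu
  have huL : ∀ c ∈ L, Δ.collin u c := fun c hc =>
    two hL pL xL hpx (on_line hM uM pM) (on_line hM uM xM) hc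
  have huy : u ≠ y := by
    rintro rfl; exact yM uM
  have hzp : ¬ Δ.collin z p := fun h => hzx (two hL pL yL hyp.symm h hzy xL)
  have hup : u ≠ p := by
    rintro rfl; exact hzp hzu
  obtain ⟨r, hru, hry⟩ := incomp (Δ := Δ) huy
  have hzy' : z ≠ y := by
    rintro rfl; exact hzx (on_line hL yL xL)
  obtain ⟨N, hN, zN, yN⟩ := exists_line hzy hzy'
  obtain ⟨w, wN, hrw⟩ := one r hN
  have hwy : w ≠ y := by
    rintro rfl; exact hry hrw
  have huw : Δ.collin u w := two hN zN yN hzy' (cs hzu) (huL y yL) wN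
  have hpw : ¬ Δ.collin p w := fun h =>
    hzp (cs (two hN wN yN hwy h (on_line hL pL yL) zN))
  have hrw' : r ≠ w := by
    rintro rfl; exact hry (on_line hN wN yN)
  obtain ⟨Q, hQ, rQ, wQ⟩ := exists_line hrw hrw'
  obtain ⟨v, vQ, hpv⟩ := one p hQ
  have hvu : Δ.collin v u := cs (two hQ rQ wQ hrw' (cs hru) huw vQ)
  have hvx : Δ.collin v x := two hM uM pM hup hvu (cs hpv) xM
  have hvy : Δ.collin v y := two hL pL xL hpx (cs hpv) hvx yL
  have hvw : v ≠ w := by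
    rintro rfl; exact hpw hpv
  exact hry (cs (two hQ vQ wQ hvw (cs hvy) (on_line hN yN wN) rQ))

/-! ### Cardinalities and rank -/

theorem card_hyp [Finite P] {s : ℕ} (hs : ∀ L ∈ Δ.lines, L.ncard = s + 1) {K : Set P}
    (hK : Δ.IsSingular K) {y a : P} (ha : a ∈ K) (hya : ¬ Δ.collin a y) :
    K.ncard = s * (K ∩ Δ.perp {y}).ncard + 1 := by
  classical
  have : Fintype P := Fintype.ofFinite P
  have key : ∀ b : P, ∃ q : P, b ∈ K → b ≠ a → ∃ L ∈ Δ.lines, a ∈ L ∧ b ∈ L ∧ q ∈ L ∧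
      q ∈ K ∩ Δ.perp {y} := by
    intro b
    by_cases hb : b ∈ K ∧ b ≠ a
    · obtain ⟨L, hL, bL, aL⟩ := exists_line (hK.2 b hb.1 a ha) hb.2
      obtain ⟨q, qL, hq⟩ := one y hL
      exact ⟨q, fun _ _ => ⟨L, hL, aL, bL, qL, sub_of hK.1 hL bL aL hb.2 hb.1 ha qL,
        mem_perp1.2 (cs hq)⟩⟩
    · exact ⟨a, fun h1 h2 => absurd ⟨h1, h2⟩ hb⟩
  choose f hf using key
  have e1 : K.ncard = (K \ {a}).ncard + 1 := (ncard_sdiff_singleton_add_one ha (toFinite _)).symm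
  rw [e1, ncard_eq_toFinset_card' (K \ {a}), ncard_eq_toFinset_card' (K ∩ Δ.perp {y})]
  rw [Finset.card_eq_sum_card_fiberwise (f := f) (t := (K ∩ Δ.perp {y}).toFinset)]
  · rw [Finset.sum_const_nat (m := s), mul_comm]
    intro h hh
    rw [mem_toFinset] at hh
    have hha : a ≠ h := by
      rintro rfl; exact hya (mem_perp1.1 hh.2)
    obtain ⟨L, hL, aL, hLh⟩ := exists_line (hK.2 a ha h hh.1) hha
    have : ({x ∈ (K \ {a}).toFinset | f x = h} : Finset P) = (L \ {a}).toFinset := by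
      ext b
      simp only [Finset.mem_filter, mem_toFinset, mem_sdiff, mem_singleton_iff]
      constructor
      · rintro ⟨⟨hb, hba⟩, rfl⟩
        obtain ⟨L', hL', aL', bL', qL', _⟩ := hf b hb hba
        exact ⟨plin hL' hL hha aL' qL' aL hLh bL', hba⟩
      · rintro ⟨hb, hba⟩
        have hbK : b ∈ K := sub_of hK.1 hL aL hLh hha ha hh.1 hb
        refine ⟨⟨hbK, hba⟩, ?_⟩
        obtain ⟨L', hL', aL', bL', qL', hq⟩ := hf b hbK hba
        have hq' : f b ∈ L := plin hL' hL hba bL' aL' hb aL qL'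
        by_contra hne
        exact hya (cs (two hL hq' hLh hne (cs (mem_perp1.1 hq.2)) (cs (mem_perp1.1 hh.2)) aL))
    rw [this, ← ncard_eq_toFinset_card']
    have := ncard_sdiff_singleton_add_one aL (toFinite _)
    rw [hs L hL] at this
    omega
  · intro b hb
    simp only [Finset.mem_coe, mem_toFinset, mem_sdiff, mem_singleton_iff] at hb ⊢
    exact (hf b hb.1 hb.2).choose_spec.2.2.2.2

/-- number of points of a projective space of vector dimension `m`. -/
def gg (s m : ℕ) : ℕ := ∑ i ∈ Finset.range m, s ^ i

theorem gg_succ (s m : ℕ) : gg s (m + 1) = s * gg s m + 1 := by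
  unfold gg
  rw [Finset.sum_range_succ', Finset.mul_sum]
  simp [pow_succ, mul_comm]

theorem two_le [Finite P] {s : ℕ} (hs : ∀ L ∈ Δ.lines, L.ncard = s + 1) : 2 ≤ s := by
  obtain ⟨L, hL⟩ := Δ.linesNonempty
  obtain ⟨a, b, c, ha, hb, hc, hab, hac, hbc⟩ := Δ.thickLines L hL
  have h1 : ({a, b, c} : Set P).ncard = 3 := by
    rw [ncard_eq_three]; exact ⟨a, b, c, hab, hac, hbc, rfl⟩
  have h2 : ({a, b, c} : Set P).ncard ≤ L.ncard := by
    apply ncard_le_ncard _ (toFinite _)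
    rintro x (rfl | rfl | rfl) <;> assumption
  have := hs L hL
  omega

theorem gg_mono {s : ℕ} (hs : 2 ≤ s) : StrictMono (gg s) := by
  apply strictMono_nat_of_lt_succ
  intro m
  unfold gg
  rw [Finset.sum_range_succ]
  have : 0 < s ^ m := by positivity
  omega

open Classical in
/-- Vector rank of a singular subspace. -/
noncomputable def rk (s : ℕ) (X : Set P) : ℕ :=
  if h : ∃ m, X.ncard = gg s m then h.choose else 0

theorem exists_rk [Finite P] {s : ℕ} (hs : ∀ L ∈ Δ.lines, L.ncard = s + 1) :
    ∀ (c : ℕ) (X : Set P), X.ncard = c → Δ.IsSingular X → ∃ m, X.ncard = gg s m := by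
  intro c
  induction c using Nat.strong_induction_on with
  | _ c ih =>
  intro X hc hX
  rcases X.eq_empty_or_nonempty with rfl | ⟨p, hp⟩
  · exact ⟨0, by simp [gg]⟩
  obtain ⟨y, hy⟩ := Δ.nondegenerate p
  change ¬ Δ.collin p y at hy
  have hlt : (X ∩ Δ.perp {y}).ncard < c := by
    rw [← hc]
    apply ncard_lt_ncard _ (toFinite _)
    exact ⟨inter_subset_left, fun h => hy (mem_perp1.1 (h hp).2)⟩
  obtain ⟨m, hm⟩ := ih _ hlt _ rfl (sing_perp hX {y})
  exact ⟨m + 1, by rw [card_hyp hs hX hp hy, hm, gg_succ]⟩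


theorem rk_spec [Finite P] {s : ℕ} (hs : ∀ L ∈ Δ.lines, L.ncard = s + 1)
    {X : Set P} (hX : Δ.IsSingular X) : X.ncard = gg s (rk s X) := by
  have h := exists_rk hs _ X rfl hX
  unfold rk
  rw [dif_pos h]
  exact h.choose_spec

theorem rk_eq [Finite P] {s : ℕ} (hs : ∀ L ∈ Δ.lines, L.ncard = s + 1)
    {X : Set P} (hX : Δ.IsSingular X) {m : ℕ} (h : X.ncard = gg s m) : rk s X = m :=
  (gg_mono (two_le hs)).injective (by rw [← rk_spec hs hX, h])

theorem rk_mono [Finite P] {s : ℕ} (hs : ∀ L ∈ Δ.lines, L.ncard = s + 1)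
    {X Y : Set P} (hX : Δ.IsSingular X) (hY : Δ.IsSingular Y) (h : X ⊆ Y) :
    rk s X ≤ rk s Y := by
  rw [← (gg_mono (two_le hs)).le_iff_le, ← rk_spec hs hX, ← rk_spec hs hY]
  exact ncard_le_ncard h (toFinite _)

theorem rk_card [Finite P] {s : ℕ} (hs : ∀ L ∈ Δ.lines, L.ncard = s + 1)
    {X Y : Set P} (hX : Δ.IsSingular X) (hY : Δ.IsSingular Y)
    (h : rk s X ≤ rk s Y) : X.ncard ≤ Y.ncard := by
  rw [rk_spec hs hX, rk_spec hs hY]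
  exact (gg_mono (two_le hs)).monotone h

theorem eq_of_rk [Finite P] {s : ℕ} (hs : ∀ L ∈ Δ.lines, L.ncard = s + 1)
    {X Y : Set P} (hX : Δ.IsSingular X) (hY : Δ.IsSingular Y) (h : X ⊆ Y)
    (h2 : rk s Y ≤ rk s X) : X = Y :=
  eq_of_subset_of_ncard_le h (rk_card hs hY hX h2) (toFinite _)

theorem rk_lt [Finite P] {s : ℕ} (hs : ∀ L ∈ Δ.lines, L.ncard = s + 1)
    {X Y : Set P} (hX : Δ.IsSingular X) (hY : Δ.IsSingular Y) (h : X ⊆ Y)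
    {p : P} (hp : p ∈ Y) (hpX : p ∉ X) : rk s X < rk s Y := by
  by_contra h2
  exact hpX ((eq_of_rk hs hX hY h (not_lt.1 h2)).symm ▸ hp)

theorem rk_hyp [Finite P] {s : ℕ} (hs : ∀ L ∈ Δ.lines, L.ncard = s + 1)
    {K : Set P} (hK : Δ.IsSingular K) {y a : P} (ha : a ∈ K)
    (hya : ¬ Δ.collin a y) : rk s K = rk s (K ∩ Δ.perp {y}) + 1 :=
  rk_eq hs hK (by rw [card_hyp hs hK ha hya, gg_succ, ← rk_spec hs (sing_perp hK _)])

theorem rk_hyp_le [Finite P] {s : ℕ} (hs : ∀ L ∈ Δ.lines, L.ncard = s + 1)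
    {K : Set P} (hK : Δ.IsSingular K) (y : P) :
    rk s K ≤ rk s (K ∩ Δ.perp {y}) + 1 := by
  by_cases h : K ⊆ Δ.perp {y}
  · rw [inter_eq_left.2 h]; omega
  · obtain ⟨a, ha, h'⟩ := not_subset.1 h
    exact (rk_hyp hs hK ha (fun hh => h' (mem_perp1.2 hh))).le

variable (Δ) in
/-- span of `X` and `a` -/
def sp (X : Set P) (a : P) : Set P := Δ.perp (Δ.perp (insert a X))

theorem sp_sub (X : Set P) (a : P) : X ⊆ Δ.sp X a :=
  fun x hx y hy => cs (hy x (mem_insert_of_mem a hx))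

theorem sp_mem (X : Set P) (a : P) : a ∈ Δ.sp X a :=
  fun y hy => cs (hy a (mem_insert a X))

theorem sp_sing {X : Set P} (hX : Δ.IsSingular X) {a : P} (ha : a ∈ Δ.perp X) :
    Δ.IsSingular (Δ.sp X a) := by
  refine ⟨perp_subspace _, ?_⟩
  have h1 : insert a X ⊆ Δ.perp (insert a X) := by
    rintro b hb c hc
    rcases hb with rfl | hb <;> rcases hc with rfl | hc
    · exact cr Δ _
    · exact ha c hc
    · exact cs (ha b hb)
    · exact hX.2 b hb c hc
  intro b hb c hc
  exact hb c (perp_anti h1 hc)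

theorem sp_rk [Finite P] {s : ℕ} (hs : ∀ L ∈ Δ.lines, L.ncard = s + 1)
    {X : Set P} (hX : Δ.IsSingular X) {a : P} (ha : a ∈ Δ.perp X) (haX : a ∉ X) :
    rk s (Δ.sp X a) = rk s X + 1 := by
  obtain ⟨y, hy, hya⟩ := res hX ha haX
  rw [rk_hyp hs (sp_sing hX ha) (sp_mem X a) (fun h => hya (cs h))]
  congr 2
  apply Subset.antisymm
  · rintro b ⟨hb, hby⟩
    by_contra hbX
    have hS := sp_sing hX ha
    have hbX' : b ∈ Δ.perp X := fun c hc => hS.2 b hb c (sp_sub X a hc)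
    obtain ⟨r, hr, hrb⟩ := res hX hbX' hbX
    obtain ⟨v, hv, hva, hvb⟩ := core (X := X) (a := a) (b := b) (z := y) (r := r) hbX' hy hr
      (hS.2 a (sp_mem X a) b hb) (cs (mem_perp1.1 hby)) hya hrb
    refine hvb (cs (hb v ?_))
    rintro c (rfl | hc)
    · exact hva
    · exact hv c hc
  · exact fun b hb => ⟨sp_sub X a hb, mem_perp1.2 (cs (hy b hb))⟩

theorem sp_le {X Y : Set P} (hY : Δ.perp (Δ.perp Y) ⊆ Y) {a : P} (hXY : X ⊆ Y) (ha : a ∈ Y) :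
    Δ.sp X a ⊆ Y :=
  (perp_anti (perp_anti (insert_subset ha hXY))).trans hY

theorem closed [Finite P] {Y : Set P} (hY : Δ.IsSingular Y) : Δ.perp (Δ.perp Y) ⊆ Y := by
  intro x hx
  by_contra hxY
  obtain ⟨y, hy, hyx⟩ := res hY (perp_anti (sub_perp hY) hx) hxY
  exact hyx (cs (hx y hy))

/-- symmetric rank lemma -/
theorem rk_perp [Finite P] {s : ℕ} (hs : ∀ L ∈ Δ.lines, L.ncard = s + 1)
    {S X : Set P} (hS : Δ.IsSingular S) (hX : Δ.IsSingular X) :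
    ∀ (d : ℕ) (R : Set P), Δ.IsSingular R → X ⊆ R → rk s R = rk s X + d →
      rk s (S ∩ Δ.perp X) ≤ rk s (S ∩ Δ.perp R) + d := by
  intro d
  induction d with
  | zero =>
    intro R hR hXR h
    rw [eq_of_rk hs hX hR hXR (by omega)]; rfl
  | succ d ih =>
    intro R hR hXR h
    have hne : ∃ b ∈ R, b ∉ X := by
      by_contra! hh
      have := rk_mono hs hR hX hh
      omega
    obtain ⟨b, hb, hbX⟩ := hne
    obtain ⟨y, hy, hyb⟩ := res hX (fun c hc => hR.2 b hb c (hXR hc)) hbX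
    have hby : ¬ Δ.collin b y := fun h => hyb (cs h)
    have h1 := rk_hyp hs hR hb hby
    have h2 := ih (R ∩ Δ.perp {y}) (sing_perp hR _)
      (fun c hc => ⟨hXR hc, mem_perp1.2 (cs (hy c hc))⟩) (by omega)
    have h3 := rk_hyp_le hs (sing_perp hS (R ∩ Δ.perp {y})) b
    have h4 : S ∩ Δ.perp (R ∩ Δ.perp {y}) ∩ Δ.perp {b} = S ∩ Δ.perp R := by
      apply Subset.antisymm
      · rintro v ⟨⟨hv, hv1⟩, hv2⟩
        exact ⟨hv, gen hR hb hby hv1 (mem_perp1.1 hv2)⟩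
      · rintro v ⟨hv, hv1⟩
        exact ⟨⟨hv, perp_anti inter_subset_left hv1⟩, mem_perp1.2 (hv1 b hb)⟩
    rw [h4] at h3
    omega

theorem rk_perp_le [Finite P] {s : ℕ} (hs : ∀ L ∈ Δ.lines, L.ncard = s + 1)
    {R S : Set P} (hR : Δ.IsSingular R) (hS : Δ.IsSingular S)
    (h : rk s R = rk s S) : rk s (R ∩ Δ.perp S) ≤ rk s (S ∩ Δ.perp R) := by
  have h0 := sing_perp hR S
  have h1 := rk_mono hs h0 hR inter_subset_left
  have h2 := rk_perp hs hS h0 (rk s R - rk s (R ∩ Δ.perp S)) R hR inter_subset_left (by omega)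
  have h3 : S ∩ Δ.perp (R ∩ Δ.perp S) = S :=
    inter_eq_left.2 fun c hc x hx => cs (hx.2 c hc)
  rw [h3] at h2
  omega

theorem subsing {X : Set P} (hX : Δ.IsSingular X) {a : P} (h : ∀ c ∈ X, ¬ Δ.collin c a) {u v : P}
    (hu : u ∈ X) (hv : v ∈ X) : u = v := by
  by_contra huv
  obtain ⟨L, hL, uL, vL⟩ := exists_line (hX.2 u hu v hv) huv
  obtain ⟨q, qL, hq⟩ := one a hL
  exact h q (sub_of hX.1 hL uL vL huv hu hv qL) (cs hq)

theorem pencil [Finite P] {s : ℕ} (hs : ∀ L ∈ Δ.lines, L.ncard = s + 1)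
    {R : Set P} (hR : Δ.IsSingular R) {x p y : P} (hx : x ∈ Δ.perp R) (hxR : x ∉ R)
    (hp : p ∈ R) (hpy : ¬ Δ.collin p y) (A : Set (Set P))
    (hA : ∀ S ∈ A, ∀ c ∈ R, c ∉ Δ.perp S) (hc : A.ncard < s) :
    ∃ R', Δ.IsSingular R' ∧ rk s R' = rk s R ∧ R' ⊆ Δ.sp R x ∧ R' ∩ R = R ∩ Δ.perp {y} ∧
      ∀ S ∈ A, ∀ c ∈ R', c ∉ Δ.perp S := by
  set H := R ∩ Δ.perp {y} with hH
  have hHs : Δ.IsSingular H := sing_perp hR _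
  have hHR : H ⊆ R := inter_subset_left
  have hrH : rk s R = rk s H + 1 := rk_hyp hs hR hp hpy
  have hK := sp_sing hR hx
  have hrK := sp_rk hs hR hx hxR
  have hpx : p ≠ x := by
    rintro rfl; exact hxR hp
  have hxK := sp_mem (Δ := Δ) R x
  have hRK := sp_sub (Δ := Δ) R x
  obtain ⟨L, hL, pL, xL⟩ := exists_line (cs (hx p hp)) hpx
  have hLK : L ⊆ Δ.sp R x := fun c hc => sub_of hK.1 hL pL xL hpx (hRK hp) hxK hc
  have hLR : ∀ z ∈ L, z ≠ p → z ∉ R := fun z hz hzp h =>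
    hxR (sub_of hR.1 hL hz pL hzp h hp xL)
  have hLH : ∀ z ∈ L, z ∈ Δ.perp H := fun z hz c hc => hK.2 z (hLK hz) c (hRK (hHR hc))
  have good : ∀ z ∈ L, z ≠ p → Δ.IsSingular (Δ.sp H z) ∧ rk s (Δ.sp H z) = rk s R ∧
      Δ.sp H z ⊆ Δ.sp R x ∧ Δ.sp H z ∩ R = H := by
    intro z hz hzp
    have hzR := hLR z hz hzp
    have h1 := sp_sing hHs (hLH z hz)
    have h2 := sp_rk hs hHs (hLH z hz) (fun h => hzR (hHR h))
    refine ⟨h1, by omega, sp_le (closed hK) (hHR.trans hRK) (hLK hz), ?_⟩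
    have h3 : Δ.IsSingular (Δ.sp H z ∩ R) := sing_inter h1 hR.1
    have h4 := rk_lt hs h3 h1 inter_subset_left (sp_mem H z) (fun h => hzR h.2)
    exact (eq_of_rk hs hHs h3 (fun c hc => ⟨sp_sub H z hc, hHR hc⟩) (by omega)).symm
  by_contra hcon
  have bad : ∀ z : P, ∃ S : Set P, ∃ u : P, z ∈ L → z ≠ p → S ∈ A ∧ u ∈ Δ.sp H z ∧ u ∈ Δ.perp S := by
    intro z
    by_cases hz : z ∈ L ∧ z ≠ p
    · obtain ⟨h1, h2, h3, h4⟩ := good z hz.1 hz.2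
      by_contra! hh
      refine hcon ⟨Δ.sp H z, h1, h2, h3, h4, ?_⟩
      intro S hS c hc hcS
      obtain ⟨_, _, hh⟩ := hh S c
      exact hh hS hc hcS
    · exact ⟨∅, z, fun h1 h2 => absurd ⟨h1, h2⟩ hz⟩
  choose f u hfu using bad
  obtain ⟨e, he, hex⟩ := res hR hx hxR
  have hKe : Δ.sp R x ∩ Δ.perp {e} = R := by
    have h1 := rk_hyp hs hK hxK (fun h => hex (cs h))
    exact (eq_of_rk hs hR (sing_perp hK _)
      (fun c hc => ⟨hRK hc, mem_perp1.2 (cs (he c hc))⟩) (by omega)).symm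
  have hinj : InjOn f (L \ {p}) := by
    intro z1 hz1 z2 hz2 h12
    by_contra hne
    obtain ⟨a1, a2, a3⟩ := hfu z1 hz1.1 hz1.2
    obtain ⟨b1, b2, b3⟩ := hfu z2 hz2.1 hz2.2
    obtain ⟨g1, g2, g3, g4⟩ := good z1 hz1.1 hz1.2
    obtain ⟨k1, k2, k3, k4⟩ := good z2 hz2.1 hz2.2
    rw [← h12] at b3
    have huv : u z1 = u z2 := by
      apply subsing (sing_perp hK (f z1)) (a := e) _ ⟨g3 a2, a3⟩ ⟨k3 b2, b3⟩
      intro c hc hce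
      have : c ∈ R := hKe ▸ ⟨hc.1, mem_perp1.2 hce⟩
      exact hA _ a1 c this hc.2
    have huH : u z1 ∉ H := fun h => hA _ a1 _ (hHR h) a3
    have hI : Δ.IsSingular (Δ.sp H z1 ∩ Δ.sp H z2) := sing_inter g1 k1.1
    have hrI : rk s H < rk s (Δ.sp H z1 ∩ Δ.sp H z2) :=
      rk_lt hs hHs hI (fun c hc => ⟨sp_sub H z1 hc, sp_sub H z2 hc⟩) ⟨a2, huv ▸ b2⟩ huH
    have e1 := eq_of_rk hs hI g1 inter_subset_left (by omega)
    have hz1' : z1 ∈ Δ.sp H z2 := (e1.symm ▸ sp_mem H z1 : z1 ∈ Δ.sp H z1 ∩ Δ.sp H z2).2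
    have hp2 : p ∈ Δ.sp H z2 := sub_of k1.1 hL hz1.1 hz2.1 hne hz1' (sp_mem H z2) pL
    have : p ∈ H := k4 ▸ ⟨hp2, hp⟩
    exact hpy (mem_perp1.1 this.2)
  have h1 := ncard_le_ncard_of_injOn f (fun z hz => (hfu z hz.1 hz.2).1) hinj (toFinite A)
  have h2 := ncard_sdiff_singleton_add_one pL (toFinite _)
  rw [hs L hL] at h2
  omega

theorem exists_out [Finite P] {s : ℕ} (hs : ∀ L ∈ Δ.lines, L.ncard = s + 1)
    {R M : Set P} (hR : Δ.IsSingular R) (hM : Δ.IsSingular M)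
    (h : rk s R < rk s M) : ∃ x ∈ Δ.perp R, x ∉ R := by
  by_contra! hh
  have h0 : Δ.IsSingular (R ∩ M) := sing_inter hR hM.1
  have h1 := rk_mono hs h0 hR inter_subset_left
  have h2 := rk_perp hs hM h0 (rk s R - rk s (R ∩ M)) R hR inter_subset_left (by omega)
  have h3 : M ∩ Δ.perp (R ∩ M) = M := inter_eq_left.2 fun c hc x hx => hM.2 c hc x hx.2
  rw [h3] at h2
  have h4 := rk_mono hs (sing_perp hM R) h0 (fun c hc => ⟨hh c hc.2, hc.1⟩)
  omega

theorem step1 [Finite P] {s : ℕ} (hs : ∀ L ∈ Δ.lines, L.ncard = s + 1)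
    {M : Set P} (hM : Δ.IsSingular M) {r : ℕ} (hr : r < rk s M) (A : Set (Set P))
    (hc : A.ncard < s) {S : Set P} (hS : Δ.IsSingular S) (hSr : rk s S = r) :
    ∀ (m : ℕ) (R : Set P), (R ∩ Δ.perp S).ncard + (R ∩ S).ncard = m → Δ.IsSingular R →
      rk s R = r → (∀ S ∈ A, ∀ c ∈ R, c ∉ Δ.perp S) →
      ∃ R', Δ.IsSingular R' ∧ rk s R' = r ∧ ∀ S' ∈ insert S A, ∀ c ∈ R', c ∉ Δ.perp S' := by
  intro m
  induction m using Nat.strong_induction_on with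
  | _ m ih =>
  intro R hm hR hRr hRA
  by_cases hD : ∀ c ∈ R, c ∉ Δ.perp S
  · refine ⟨R, hR, hRr, ?_⟩
    rintro S' (rfl | hS')
    · exact hD
    · exact hRA S' hS'
  push Not at hD
  obtain ⟨p, hp, hpS⟩ := hD
  obtain ⟨y, hy⟩ := Δ.nondegenerate p
  change ¬ Δ.collin p y at hy
  by_cases hst : ∃ e ∈ S ∩ Δ.perp R, e ∉ R
  · obtain ⟨e, ⟨heS, he⟩, heR⟩ := hst
    obtain ⟨x, hx, hxe⟩ := res hR he heR
    have hxR : x ∉ R := fun h => hxe (cs (he x h))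
    obtain ⟨R', h1, h2, h3, h4, h5⟩ := pencil hs hR hx hxR hp hy A hRA hc
    have hK := sp_sing hR hx
    have hrK := sp_rk hs hR hx hxR
    have hKe : Δ.sp R x ∩ Δ.perp {e} = R := by
      have h1 := rk_hyp hs hK (sp_mem R x) hxe
      exact (eq_of_rk hs hR (sing_perp hK _)
        (fun c hc => ⟨sp_sub R x hc, mem_perp1.2 (cs (he c hc))⟩) (by omega)).symm
    have hin : ∀ c ∈ R', c ∈ Δ.perp S → c ∈ R := fun c hc hcS =>
      hKe ▸ ⟨h3 hc, mem_perp1.2 (hcS e heS)⟩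
    have l1 : (R' ∩ Δ.perp S).ncard < (R ∩ Δ.perp S).ncard := by
      apply ncard_lt_ncard _ (toFinite _)
      refine ⟨fun c hc => ⟨hin c hc.1 hc.2, hc.2⟩, fun h => ?_⟩
      have : p ∈ R ∩ Δ.perp {y} := h4 ▸ ⟨(h ⟨hp, hpS⟩).1, hp⟩
      exact hy (mem_perp1.1 this.2)
    have l2 : (R' ∩ S).ncard ≤ (R ∩ S).ncard :=
      ncard_le_ncard (fun c hc => ⟨hin c hc.1 (sub_perp hS hc.2), hc.2⟩) (toFinite _)
    exact ih _ (by omega) R' rfl h1 (by omega) h5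
  · push Not at hst
    have e0 : R ∩ S = R ∩ Δ.perp S := by
      have hRS : Δ.IsSingular (R ∩ S) := sing_inter hR hS.1
      apply eq_of_rk hs hRS (sing_perp hR S) (fun c hc => ⟨hc.1, sub_perp hS hc.2⟩)
      exact (rk_perp_le hs hR hS (by omega)).trans
        (rk_mono hs (sing_perp hS R) hRS fun c hc => ⟨hst c hc, hc.1⟩)
    obtain ⟨x, hx, hxR⟩ := exists_out hs hR hM (by omega)
    obtain ⟨R', h1, h2, h3, h4, h5⟩ := pencil hs hR hx hxR hp hy A hRA hc
    have hK := sp_sing hR hx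
    have l2 : (R' ∩ S).ncard < (R ∩ S).ncard := by
      apply ncard_lt_ncard _ (toFinite _)
      refine ⟨fun c hc => ⟨hst c ⟨hc.2, fun d hd => hK.2 c (h3 hc.1) d (sp_sub R x hd)⟩, hc.2⟩,
        fun h => ?_⟩
      have hpS' : p ∈ R ∩ S := e0.symm ▸ ⟨hp, hpS⟩
      have : p ∈ R ∩ Δ.perp {y} := h4 ▸ ⟨(h hpS').1, hp⟩
      exact hy (mem_perp1.1 this.2)
    have l1 : (R' ∩ Δ.perp S).ncard ≤ (R ∩ Δ.perp S).ncard := by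
      have hE := sing_perp h1 S
      have hD := sing_perp hR S
      apply rk_card hs hE hD
      have q1 := rk_hyp hs hD ⟨hp, hpS⟩ hy
      have hHs : Δ.IsSingular (R ∩ Δ.perp {y}) := sing_perp hR _
      have q2 := rk_hyp hs hR hp hy
      have : ∃ b ∈ R', b ∉ R := by
        by_contra! hh
        have : R' = R := eq_of_rk hs h1 hR hh (by omega)
        rw [this, inter_self] at h4
        have : p ∈ R ∩ Δ.perp {y} := h4 ▸ hp
        exact hy (mem_perp1.1 this.2)
      obtain ⟨b, hb, hbR⟩ := this
      have hbH : b ∈ Δ.perp (R ∩ Δ.perp {y}) := fun c hc =>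
        h1.2 b hb c (h4.symm ▸ hc : c ∈ R' ∩ R).1
      obtain ⟨w, hw, hwb⟩ := res hHs hbH (fun h => hbR h.1)
      have q3 := rk_hyp hs h1 hb (fun h => hwb (cs h))
      have q4 : R ∩ Δ.perp {y} = R' ∩ Δ.perp {w} :=
        eq_of_rk hs hHs (sing_perp h1 _)
          (fun c hc => ⟨(h4.symm ▸ hc : c ∈ R' ∩ R).1, mem_perp1.2 (cs (hw c hc))⟩) (by omega)
      have q5 := rk_hyp_le hs hE w
      have q6 := rk_mono hs (sing_perp hE {w}) (sing_perp hD {y}) (by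
        rintro c ⟨⟨hc1, hc2⟩, hc3⟩
        have : c ∈ R ∩ Δ.perp {y} := q4 ▸ ⟨hc1, hc3⟩
        exact ⟨⟨this.1, hc2⟩, this.2⟩)
      omega
    exact ih _ (by omega) R' rfl h1 (by omega) h5

theorem exists_sub [Finite P] {s : ℕ} (hs : ∀ L ∈ Δ.lines, L.ncard = s + 1)
    {M : Set P} (hM : Δ.IsSingular M) :
    ∀ (d r : ℕ), rk s M = r + d → ∃ R, Δ.IsSingular R ∧ rk s R = r ∧ R ⊆ M := by
  intro d
  induction d with
  | zero => intro r h; exact ⟨M, hM, h, Subset.rfl⟩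
  | succ d ih =>
    intro r h
    obtain ⟨R, h1, h2, h3⟩ := ih (r + 1) (by omega)
    have : R.Nonempty := by
      by_contra hne
      rw [not_nonempty_iff_eq_empty] at hne
      have := rk_spec hs h1
      rw [h2, gg_succ, hne, ncard_empty] at this
      omega
    obtain ⟨p, hp⟩ := this
    obtain ⟨y, hy⟩ := Δ.nondegenerate p
    have := rk_hyp hs h1 hp hy
    exact ⟨R ∩ Δ.perp {y}, sing_perp h1 _, by omega, inter_subset_left.trans h3⟩

theorem part1 [Finite P] {s : ℕ} (hs : ∀ L ∈ Δ.lines, L.ncard = s + 1)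
    {M : Set P} (hM : Δ.IsSingular M) {r : ℕ} (hr : r < rk s M) (T : Set (Set P)) :
    T.ncard ≤ s → (∀ S ∈ T, Δ.IsSingular S ∧ rk s S = r) →
      ∃ R, Δ.IsSingular R ∧ rk s R = r ∧ ∀ S ∈ T, ∀ c ∈ R, c ∉ Δ.perp S := by
  induction T, toFinite T using Set.Finite.induction_on with
  | empty =>
    intro _ _
    obtain ⟨R, h1, h2, _⟩ := exists_sub hs hM (rk s M - r) r (by omega)
    exact ⟨R, h1, h2, by simp⟩
  | @insert S A hSA _ ih =>
    intro hc hT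
    rw [ncard_insert_of_notMem hSA (toFinite _)] at hc
    obtain ⟨R, h1, h2, h3⟩ := ih (by omega) (fun S' h => hT S' (mem_insert_of_mem _ h))
    obtain ⟨hS, hSr⟩ := hT S (mem_insert _ _)
    exact step1 hs hM hr A (by omega) hS hSr _ R rfl h1 h2 h3

theorem opp_of [Finite P] {s : ℕ} (hs : ∀ L ∈ Δ.lines, L.ncard = s + 1)
    {R S : Set P} (hR : Δ.IsSingular R) (hS : Δ.IsSingular S)
    (h : rk s R = rk s S) (hRS : ∀ c ∈ R, c ∉ Δ.perp S) : Δ.Opposite R S := by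
  have hSR : ∀ c ∈ S, c ∉ Δ.perp R := by
    intro c hc hcR
    have h0 : rk s (S ∩ Δ.perp R) ≤ rk s (R ∩ Δ.perp S) := rk_perp_le hs hS hR h.symm
    have h1 := rk_card hs (sing_perp hS R) (sing_perp hR S) h0
    have h2 : R ∩ Δ.perp S = ∅ := by
      ext d; simp only [mem_inter_iff, mem_empty_iff_false, iff_false]
      exact fun hd => hRS d hd.1 hd.2
    rw [h2, ncard_empty] at h1
    have h3 : 0 < (S ∩ Δ.perp R).ncard := (ncard_pos (toFinite _)).2 ⟨c, hc, hcR⟩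
    omega
  rintro p (hp | hp)
  · have := hRS p hp
    rw [mem_perp] at this
    push Not at this
    obtain ⟨x, hx, h⟩ := this
    exact ⟨x, Or.inr hx, h⟩
  · have := hSR p hp
    rw [mem_perp] at this
    push Not at this
    obtain ⟨x, hx, h⟩ := this
    exact ⟨x, Or.inl hx, h⟩

/-! ### maximal subspaces -/

theorem max_perp [Finite P] {s : ℕ} (hs : ∀ L ∈ Δ.lines, L.ncard = s + 1)
    {n : ℕ} (hmax : ∀ X, Δ.IsSingular X → rk s X ≤ n) {M : Set P}
    (hM : Δ.IsSingular M) (hn : rk s M = n) {x : P} (hx : x ∈ Δ.perp M) : x ∈ M := by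
  by_contra hxM
  have h1 := sp_rk hs hM hx hxM
  have h2 := hmax _ (sp_sing hM hx)
  omega

theorem step2 [Finite P] {s : ℕ} (hs : ∀ L ∈ Δ.lines, L.ncard = s + 1)
    {n t : ℕ} (hmax : ∀ X, Δ.IsSingular X → rk s X ≤ n)
    (ht : ∀ H, Δ.IsSingular H → rk s H + 1 = n →
      {M : Set P | (Δ.IsSingular M ∧ rk s M = n) ∧ H ⊆ M}.ncard = t + 1)
    (A : Set (Set P)) (hc : A.ncard < t) (hA : ∀ S ∈ A, Δ.IsSingular S)
    {S : Set P} (hS : Δ.IsSingular S) :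
    ∀ (m : ℕ) (M : Set P), (M ∩ S).ncard = m → Δ.IsSingular M →
      rk s M = n → (∀ S ∈ A, ∀ c ∈ M, c ∉ S) →
      ∃ R', Δ.IsSingular R' ∧ rk s R' = n ∧ ∀ S' ∈ insert S A, ∀ c ∈ R', c ∉ S' := by
  intro m
  induction m using Nat.strong_induction_on with
  | _ m ih =>
  intro M hm hM hMn hMA
  by_cases hD : ∀ c ∈ M, c ∉ S
  · refine ⟨M, hM, hMn, ?_⟩
    rintro S' (rfl | hS')
    · exact hD
    · exact hMA S' hS'
  push Not at hD
  obtain ⟨p, hp, hpS⟩ := hD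
  obtain ⟨y, hy⟩ := Δ.nondegenerate p
  change ¬ Δ.collin p y at hy
  set H := M ∩ Δ.perp {y} with hH
  have hHs : Δ.IsSingular H := sing_perp hM _
  have hrH : rk s M = rk s H + 1 := rk_hyp hs hM hp hy
  have htH := ht H hHs (by omega)
  set F := {M : Set P | (Δ.IsSingular M ∧ rk s M = n) ∧ H ⊆ M} with hF
  have hMF : M ∈ F := ⟨⟨hM, hMn⟩, inter_subset_left⟩
  have hgood : ∃ M' ∈ F \ {M}, ∀ S ∈ A, ∀ c ∈ M', c ∉ S := by
    by_contra! hcon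
    have bad : ∀ M' : Set P, ∃ S : Set P, ∃ u : Set P → P, M' ∈ F \ {M} → S ∈ A ∧ u M' ∈ M' ∧ u M' ∈ S := by
      intro M'
      by_cases h : M' ∈ F \ {M}
      · obtain ⟨S, hS, c, h1, h2⟩ := hcon M' h
        exact ⟨S, fun _ => c, fun _ => ⟨hS, h1, h2⟩⟩
      · exact ⟨∅, fun _ => p, fun h' => absurd h' h⟩
    choose f u hfu using bad
    have hinj : InjOn f (F \ {M}) := by
      intro M1 h1 M2 h2 h12
      obtain ⟨a1, a2, a3⟩ := hfu M1 h1
      obtain ⟨b1, b2, b3⟩ := hfu M2 h2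
      obtain ⟨⟨⟨c1, c2⟩, c3⟩, c4⟩ := h1
      obtain ⟨⟨⟨d1, d2⟩, d3⟩, d4⟩ := h2
      rw [← h12] at b3
      have hSi := hA _ a1
      have huv : u M1 M1 = u M2 M2 := by
        apply subsing (sing_perp hSi H) (a := p) _ ⟨a3, fun c hc => c1.2 _ a2 c (c3 hc)⟩
          ⟨b3, fun c hc => d1.2 _ b2 c (d3 hc)⟩
        intro c hc hcp
        exact hMA _ a1 c (max_perp hs hmax hM hMn (gen hM hp hy hc.2 hcp)) hc.1
      have huH : u M1 M1 ∉ H := fun h => hMA _ a1 _ h.1 a3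
      have hI : Δ.IsSingular (M1 ∩ M2) := sing_inter c1 d1.1
      have hrI := rk_lt hs hHs hI (subset_inter c3 d3) ⟨a2, huv ▸ b2⟩ huH
      have e1 := eq_of_rk hs hI c1 inter_subset_left (by omega)
      have e2 := eq_of_rk hs hI d1 inter_subset_right (by omega)
      exact e1.symm.trans e2
    have h1 := ncard_le_ncard_of_injOn f (fun z hz => (hfu z hz).1) hinj (toFinite A)
    have h2 := ncard_sdiff_singleton_add_one hMF (toFinite _)
    omega
  obtain ⟨M', ⟨⟨⟨h1, h2⟩, h3⟩, h4⟩, h5⟩ := hgood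
  have hI : Δ.IsSingular (M' ∩ M) := sing_inter h1 hM.1
  have hIH : M' ∩ M = H := by
    have hHI : H ⊆ M' ∩ M := fun c hc => ⟨h3 hc, hc.1⟩
    refine (eq_of_rk hs hHs hI hHI ?_).symm
    by_contra hlt
    have e1 := eq_of_rk hs hI h1 inter_subset_left (by omega)
    have e2 := eq_of_rk hs hI hM inter_subset_right (by omega)
    exact h4 (e1.symm.trans e2)
  have hsub : ∀ c ∈ M', c ∈ S → c ∈ M := fun c hc hcS =>
    max_perp hs hmax hM hMn (gen hM hp hy (fun d hd => h1.2 c hc d (h3 hd)) (hS.2 c hcS p hpS))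
  have hlt : (M' ∩ S).ncard < (M ∩ S).ncard := by
    apply ncard_lt_ncard _ (toFinite _)
    refine ⟨fun c hc => ⟨hsub c hc.1 hc.2, hc.2⟩, fun h => ?_⟩
    have : p ∈ H := hIH ▸ ⟨(h ⟨hp, hpS⟩).1, hp⟩
    exact hy (mem_perp1.1 this.2)
  exact ih _ (by omega) M' rfl h1 h2 h5

theorem part2 [Finite P] {s : ℕ} (hs : ∀ L ∈ Δ.lines, L.ncard = s + 1)
    {n t : ℕ} (hmax : ∀ X, Δ.IsSingular X → rk s X ≤ n)
    (ht : ∀ H, Δ.IsSingular H → rk s H + 1 = n →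
      {M : Set P | (Δ.IsSingular M ∧ rk s M = n) ∧ H ⊆ M}.ncard = t + 1)
    {M : Set P} (hM : Δ.IsSingular M) (hMn : rk s M = n) (T : Set (Set P)) :
    T.ncard ≤ t → (∀ S ∈ T, Δ.IsSingular S) →
      ∃ R, Δ.IsSingular R ∧ rk s R = n ∧ ∀ S ∈ T, ∀ c ∈ R, c ∉ S := by
  induction T, toFinite T using Set.Finite.induction_on with
  | empty => exact fun _ _ => ⟨M, hM, hMn, by simp⟩
  | @insert S A hSA _ ih =>
    intro hc hT
    rw [ncard_insert_of_notMem hSA (toFinite _)] at hc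
    have hT' : ∀ S ∈ A, Δ.IsSingular S := fun S' h => hT S' (mem_insert_of_mem _ h)
    obtain ⟨R, h1, h2, h3⟩ := ih (by omega) hT'
    exact step2 hs hmax ht A (by omega) hT' (hT S (mem_insert _ _)) _ R rfl h1 h2 h3

/-! ### dimension -/

theorem chain_le [Finite P] {s : ℕ} (hs : ∀ L ∈ Δ.lines, L.ncard = s + 1)
    {k : ℕ} {S : Set P} (h : Δ.HasChain k S) : k + 1 ≤ rk s S := by
  obtain ⟨c, h1, h2, h3, h4⟩ := h
  have key : ∀ (i : ℕ) (hi : i < k + 1), i + 1 ≤ rk s (c ⟨i, hi⟩) := by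
    intro i
    induction i with
    | zero =>
      intro hi
      exact (rk_eq hs (h1 _) (m := 1) (by simpa [gg] using h3)).ge
    | succ i ih =>
      intro hi
      have h5 := h2 ⟨i, by omega⟩ ⟨i + 1, hi⟩ (by simp)
      obtain ⟨p, hp, hp'⟩ := not_subset.1 h5.2
      have := rk_lt hs (h1 _) (h1 _) h5.1 hp hp'
      have := ih (by omega)
      omega
  have := key k (by omega)
  rw [← h4]
  exact this

theorem chain_of [Finite P] {s : ℕ} (hs : ∀ L ∈ Δ.lines, L.ncard = s + 1)
    : ∀ (k : ℕ) (S : Set P), Δ.IsSingular S → rk s S = k + 1 → Δ.HasChain k S := by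
  intro k
  induction k with
  | zero =>
    intro S hS h
    refine ⟨fun _ => S, fun _ => hS, ?_, ?_, rfl⟩
    · intro i j hij
      exact absurd hij (by rw [Fin.lt_def]; omega)
    · have := rk_spec hs hS
      rw [h] at this
      simpa [gg] using this
  | succ k ih =>
    intro S hS h
    obtain ⟨H, h1, h2, h3⟩ := exists_sub hs hS 1 (k + 1) (by omega)
    obtain ⟨c, c1, c2, c3, c4⟩ := ih H h1 h2
    have hHS : H ⊂ S := by
      refine ⟨h3, fun h' => ?_⟩
      have := rk_mono hs hS h1 h'
      omega
    refine ⟨Fin.snoc c S, ?_, ?_, ?_, ?_⟩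
    · intro i
      refine Fin.lastCases ?_ (fun i => ?_) i
      · simpa using hS
      · simpa using c1 i
    · intro i j
      refine Fin.lastCases ?_ (fun j => ?_) j
      · refine Fin.lastCases ?_ (fun i => ?_) i
        · intro h; exact absurd h (lt_irrefl _)
        · intro _
          simp only [Fin.snoc_castSucc, Fin.snoc_last]
          rcases (Fin.le_last i).eq_or_lt with rfl | hi
          · rw [c4]; exact hHS
          · exact (c4 ▸ c2 i _ hi).trans hHS
      · refine Fin.lastCases ?_ (fun i => ?_) i
        · intro h
          exact absurd h (not_lt.2 (Fin.le_last _))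
        · intro h
          simp only [Fin.snoc_castSucc]
          exact c2 i j (by simpa using h)
    · have : (0 : Fin (k + 1 + 1)) = Fin.castSucc 0 := rfl
      rw [this, Fin.snoc_castSucc]; exact c3
    · simp

theorem dim_iff [Finite P] {s : ℕ} (hs : ∀ L ∈ Δ.lines, L.ncard = s + 1)
    {k : ℕ} {S : Set P} : Δ.SingDim S k ↔ Δ.IsSingular S ∧ rk s S = k + 1 := by
  constructor
  · rintro ⟨h1, h2, h3⟩
    refine ⟨h1, ?_⟩
    have h4 := chain_le hs h2
    by_contra hne
    obtain ⟨m, hm⟩ : ∃ m, rk s S = (k + 1 + m) + 1 := ⟨rk s S - k - 2, by omega⟩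
    apply h3
    clear h3
    obtain ⟨c, c1, c2, c3, c4⟩ := chain_of hs _ S h1 hm
    refine ⟨fun i => if i = Fin.last (k + 1) then S else c ⟨i, by omega⟩, ?_, ?_, ?_, by simp⟩
    · intro i
      dsimp only
      split_ifs
      · exact h1
      · exact c1 _
    · intro i j hij
      dsimp only
      have hi : i ≠ Fin.last (k + 1) := (lt_of_lt_of_le hij (Fin.le_last j)).ne
      rw [if_neg hi]
      split_ifs with hj
      · rw [← c4]
        apply c2
        rw [Fin.lt_def]
        have : (i : ℕ) < k + 1 := Fin.val_lt_last hi
        simp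
        omega
      · exact c2 _ _ (Fin.lt_def.2 (Fin.lt_def.1 hij))
    · dsimp only
      rw [if_neg (by intro h; have := congrArg Fin.val h; simp at this)]
      exact c3
  · rintro ⟨h1, h2⟩
    refine ⟨h1, chain_of hs k S h1 h2, fun h => ?_⟩
    have := chain_le hs h
    omega

end PolarSpace

/-- In a finite polar space of rank `n ≥ 2` and order `(s,t)`, every set of at
most `s` singular subspaces of a fixed dimension `k ≤ n-2` admits a common
opposite singular subspace of the same dimension, and, if `t > 1`, every set of
at most `t` maximal singular subspaces admits a common opposite one. -/
theorem stmt18 {P : Type*} [Finite P] (Δ : PolarSpace P) (n s t : ℕ) (hn : 2 ≤ n)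
    -- rank `n`: singular subspaces have dimension at most `n-1`, attained
    (hrank₁ : ∀ (S : Set P) (k : ℕ), Δ.SingDim S k → k ≤ n - 1)
    (hrank₂ : ∃ S : Set P, Δ.SingDim S (n - 1))
    -- order `(s,t)`:
    (horder₁ : ∀ L ∈ Δ.lines, L.ncard = s + 1)
    (horder₂ : ∀ S : Set P, Δ.SingDim S (n - 2) →
      {M : Set P | Δ.SingDim M (n - 1) ∧ S ⊆ M}.ncard = t + 1) :
    (∀ k ≤ n - 2, ∀ T' : Set (Set P), T'.ncard ≤ s →
      (∀ S ∈ T', Δ.SingDim S k) →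
      ∃ R : Set P, Δ.SingDim R k ∧ ∀ S ∈ T', Δ.Opposite R S) ∧
    (1 < t → ∀ T' : Set (Set P), T'.ncard ≤ t →
      (∀ S ∈ T', Δ.SingDim S (n - 1)) →
      ∃ R : Set P, Δ.SingDim R (n - 1) ∧ ∀ S ∈ T', Δ.Opposite R S) := by
  classical
  have hs := horder₁
  obtain ⟨M, hM⟩ := hrank₂
  rw [PolarSpace.dim_iff hs] at hM
  obtain ⟨hM, hMn⟩ := hM
  have hmax : ∀ X, Δ.IsSingular X → PolarSpace.rk s X ≤ n := by
    intro X hX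
    by_contra hlt
    have := hrank₁ X (PolarSpace.rk s X - 1)
      ((PolarSpace.dim_iff hs).2 ⟨hX, by omega⟩)
    omega
  refine ⟨?_, ?_⟩
  · intro k hk T hT hTS
    obtain ⟨R, h1, h2, h3⟩ := PolarSpace.part1 hs hM (r := k + 1) (by omega) T hT
      (fun S hS => (PolarSpace.dim_iff hs).1 (hTS S hS))
    refine ⟨R, (PolarSpace.dim_iff hs).2 ⟨h1, h2⟩, fun S hS => ?_⟩
    obtain ⟨g1, g2⟩ := (PolarSpace.dim_iff hs).1 (hTS S hS)
    exact PolarSpace.opp_of hs h1 g1 (by omega) (h3 S hS)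
  · intro _ T hT hTS
    have hMn' : PolarSpace.rk s M = n := by omega
    have ht : ∀ H, Δ.IsSingular H → PolarSpace.rk s H + 1 = n →
        {M : Set P | (Δ.IsSingular M ∧ PolarSpace.rk s M = n) ∧ H ⊆ M}.ncard = t + 1 := by
      intro H hH hr
      rw [← horder₂ H ((PolarSpace.dim_iff hs).2 ⟨hH, by omega⟩)]
      congr 1
      ext N
      have e : n - 1 + 1 = n := by omega
      simp only [Set.mem_ofPred_eq, PolarSpace.dim_iff hs, e]
    obtain ⟨R, h1, h2, h3⟩ := PolarSpace.part2 hs hmax ht hM hMn' T hT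
      (fun S hS => (hTS S hS).1)
    refine ⟨R, (PolarSpace.dim_iff hs).2 ⟨h1, by omega⟩, fun S hS => ?_⟩
    obtain ⟨g1, g2⟩ := (PolarSpace.dim_iff hs).1 (hTS S hS)
    refine PolarSpace.opp_of hs h1 g1 (by omega) (fun c hc hcS => h3 S hS c hc ?_)
    exact PolarSpace.max_perp hs hmax g1 (by omega) hcS
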